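/- Let n ≥ 1, m ∈ ℝ, let V : ℝ × ℝⁿ → ℝ be continuously differentiable, and let u : ℝ × ℝⁿ → ℝ be twice continuously differentiable and satisfy ∂_t² u = Δ_z u − (m² + V)·u, where Δ_z = Σ_{j=1}^n ∂²_{z_j}. Assume that for every compact interval I ⊆ ℝ: V and ∂_t V are bounded on I × ℝⁿ, and sup_{t∈I, z∈ℝⁿ} (1+|z|)^{n+1}·(|u| + |∂_t u| + |∂_t² u| + |∇_z u| + |∂_t ∇_z u| + |Δ_z u|)(t,z) < ∞. Suppose additionally there are t₀ ∈ ℝ, c > 0 and C₀ ≥ 0 such that for all t ≤ t₀ and z ∈ ℝⁿ: m² + V(t,z) ≥ c and |∂_t V(t,z)| ≤ C₀·(1+t²)^{−1}, and that the energy E_u(t) = (1/2)·∫_{ℝⁿ}((∂_t u)² + |∇_z u|² + (m²+V)u²) dz tends to 0 as t → −∞. Then u(t,z) = 0 for all t ≤ t₀ and all z ∈ ℝⁿ. -/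

import Mathlib

open MeasureTheory Filter Topology

/-- `∂_t u`. -/
noncomputable def pt {n : ℕ} (u : ℝ × EuclideanSpace ℝ (Fin n) → ℝ)
    (t : ℝ) (z : EuclideanSpace ℝ (Fin n)) : ℝ :=
  deriv (fun s : ℝ => u (s, z)) t

/-- `∂_t² u`. -/
noncomputable def ptt {n : ℕ} (u : ℝ × EuclideanSpace ℝ (Fin n) → ℝ)
    (t : ℝ) (z : EuclideanSpace ℝ (Fin n)) : ℝ :=
  deriv (fun s : ℝ => deriv (fun s' : ℝ => u (s', z)) s) t

/-- `∇_z u`, as a continuous linear functional. -/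
noncomputable def gradz {n : ℕ} (u : ℝ × EuclideanSpace ℝ (Fin n) → ℝ)
    (t : ℝ) (z : EuclideanSpace ℝ (Fin n)) : EuclideanSpace ℝ (Fin n) →L[ℝ] ℝ :=
  fderiv ℝ (fun y => u (t, y)) z

/-- `∂_t ∇_z u`. -/
noncomputable def ptgradz {n : ℕ} (u : ℝ × EuclideanSpace ℝ (Fin n) → ℝ)
    (t : ℝ) (z : EuclideanSpace ℝ (Fin n)) : EuclideanSpace ℝ (Fin n) →L[ℝ] ℝ :=
  deriv (fun s : ℝ => fderiv ℝ (fun y => u (s, y)) z) t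

/-- `Δ_z u = Σ_j ∂²_{z_j} u`. -/
noncomputable def lapz {n : ℕ} (u : ℝ × EuclideanSpace ℝ (Fin n) → ℝ)
    (t : ℝ) (z : EuclideanSpace ℝ (Fin n)) : ℝ :=
  ∑ j : Fin n,
    fderiv ℝ (fun y => fderiv ℝ (fun y' => u (t, y')) y (EuclideanSpace.single j (1 : ℝ)))
      z (EuclideanSpace.single j (1 : ℝ))

/-- The Klein–Gordon energy
`E_u(t) = ½ ∫ ((∂_t u)² + |∇_z u|² + (m² + V)u²) dz`. -/
noncomputable def KGenergy {n : ℕ} (m : ℝ) (V u : ℝ × EuclideanSpace ℝ (Fin n) → ℝ)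
    (t : ℝ) : ℝ :=
  (1 / 2) * ∫ z : EuclideanSpace ℝ (Fin n),
    ((pt u t z) ^ 2 + ‖gradz u t z‖ ^ 2 + (m ^ 2 + V (t, z)) * (u (t, z)) ^ 2)

lemma kg_div_zero {n : ℕ} (F : Fin n → EuclideanSpace ℝ (Fin n) → ℝ)
    (hF : ∀ j, ContDiff ℝ 1 (F j)) (hFi : ∀ j, Integrable (F j))
    (hdiv : Integrable (fun z => ∑ j, fderiv ℝ (F j) z (EuclideanSpace.single j (1 : ℝ)))) :
    ∫ z, ∑ j, fderiv ℝ (F j) z (EuclideanSpace.single j (1 : ℝ)) = 0 := by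
  obtain ⟨f, -, hfc, hfs, hfr, hf0⟩ :=
    exists_contDiff_tsupport_subset (E := EuclideanSpace ℝ (Fin n)) (x := 0) (n := 1)
      (s := Set.univ) Filter.univ_mem
  have hfs : ContDiff ℝ 1 f := hfs
  have hfb : ∀ z, |f z| ≤ 1 := fun z => by
    have := hfr ⟨z, rfl⟩
    rw [abs_le]; constructor <;> linarith [this.1, this.2]
  have hfd : Continuous (fderiv ℝ f) := hfs.continuous_fderiv (by simp)
  obtain ⟨K, hK⟩ := (hfc.fderiv (𝕜 := ℝ)).exists_bound_of_continuous hfd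
  have hK0 : 0 ≤ K := (norm_nonneg _).trans (hK 0)
  let a : ℕ → ℝ := fun k => 1 / ((k : ℝ) + 1)
  have ha : Tendsto a atTop (𝓝 0) := tendsto_one_div_add_atTop_nhds_zero_nat
  have hapos : ∀ k, 0 < a k := fun k => by simp only [a]; positivity
  let χ : ℕ → EuclideanSpace ℝ (Fin n) → ℝ := fun k z => f (a k • z)
  have hχs : ∀ k, ContDiff ℝ 1 (χ k) := fun k => by
    exact hfs.comp (contDiff_const_smul (a k))
  have hχc : ∀ k, HasCompactSupport (χ k) := fun k => hfc.comp_smul (hapos k).ne'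
  have hχd : ∀ k z v, fderiv ℝ (χ k) z v = a k * fderiv ℝ f (a k • z) v := fun k z v => by
    have h1 : HasFDerivAt f (fderiv ℝ f (a k • z)) (a k • z) :=
      ((hfs.differentiable (by simp)) _).hasFDerivAt
    have h2 : HasFDerivAt (fun z : EuclideanSpace ℝ (Fin n) => a k • z)
      (a k • ContinuousLinearMap.id ℝ _) z := (hasFDerivAt_id z).const_smul (a k)
    have := (h1.comp z h2).fderiv
    change fderiv ℝ (f ∘ fun z => a k • z) z v = _
    rw [this]; simp
  have key : ∀ k, ∫ z, χ k z * ∑ j, fderiv ℝ (F j) z (EuclideanSpace.single j (1 : ℝ))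
      = - ∑ j, ∫ z, fderiv ℝ (χ k) z (EuclideanSpace.single j (1 : ℝ)) * F j z := by
    intro k
    have cF : ∀ j, Continuous (fun z => fderiv ℝ (F j) z (EuclideanSpace.single j (1 : ℝ))) :=
      fun j => ((hF j).continuous_fderiv (by simp)).clm_apply continuous_const
    have cχ : ∀ j : Fin n, Continuous
        (fun z => fderiv ℝ (χ k) z (EuclideanSpace.single j (1 : ℝ))) :=
      fun j => ((hχs k).continuous_fderiv (by simp)).clm_apply continuous_const
    have i1 : ∀ j, Integrable
        (fun z => χ k z * fderiv ℝ (F j) z (EuclideanSpace.single j (1 : ℝ))) := fun j =>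
      ((hχs k).continuous.mul (cF j)).integrable_of_hasCompactSupport (hχc k).mul_right
    simp_rw [Finset.mul_sum]
    rw [integral_finsetSum _ (fun j _ => i1 j), ← Finset.sum_neg_distrib]
    refine Finset.sum_congr rfl fun j _ => ?_
    apply integral_mul_fderiv_eq_neg_fderiv_mul_of_integrable
    · apply ((cχ j).mul (hF j).continuous).integrable_of_hasCompactSupport
      exact ((hχc k).fderiv_apply (𝕜 := ℝ) _).mul_right
    · exact i1 j
    · exact ((hχs k).continuous.mul (hF j).continuous).integrable_of_hasCompactSupport
        (hχc k).mul_right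
    · exact fun x _ => (hχs k).differentiable (by simp) x
    · exact fun x _ => (hF j).differentiable (by simp) x
  have L1 : Tendsto (fun k => ∫ z, χ k z *
      ∑ j, fderiv ℝ (F j) z (EuclideanSpace.single j (1 : ℝ))) atTop
      (𝓝 (∫ z, ∑ j, fderiv ℝ (F j) z (EuclideanSpace.single j (1 : ℝ)))) := by
    apply tendsto_integral_of_dominated_convergence _ _ hdiv.norm
    · intro k
      refine ae_of_all _ fun z => ?_
      rw [norm_mul]
      exact mul_le_of_le_one_left (norm_nonneg _) (hfb _)
    · refine ae_of_all _ fun z => ?_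
      have : Tendsto (fun k => f (a k • z)) atTop (𝓝 (f ((0 : ℝ) • z))) :=
        (hfs.continuous.tendsto _).comp (ha.smul_const z)
      rw [zero_smul, hf0] at this
      simpa using this.mul_const (∑ j, fderiv ℝ (F j) z (EuclideanSpace.single j (1 : ℝ)))
    · exact fun k => (hχs k).continuous.aestronglyMeasurable.mul hdiv.aestronglyMeasurable
  have bd : ∀ k z (j : Fin n), |fderiv ℝ (χ k) z (EuclideanSpace.single j (1 : ℝ))| ≤ a k * K := by
    intro k z j
    rw [hχd, abs_mul, abs_of_pos (hapos k)]
    have := (fderiv ℝ f (a k • z)).le_opNorm (EuclideanSpace.single j (1 : ℝ))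
    simp at this
    exact mul_le_mul_of_nonneg_left (this.trans (hK _)) (hapos k).le
  have L2 : ∀ j, Tendsto (fun k =>
      ∫ z, fderiv ℝ (χ k) z (EuclideanSpace.single j (1 : ℝ)) * F j z) atTop (𝓝 0) := by
    intro j
    have : Tendsto (fun k => a k * K * ∫ z, |F j z|) atTop (𝓝 0) := by
      simpa using (ha.mul_const K).mul_const (∫ z, |F j z|)
    refine squeeze_zero_norm (fun k => ?_) this
    rw [← integral_const_mul]
    refine norm_integral_le_of_norm_le ((hFi j).abs.const_mul _) (ae_of_all _ fun z => ?_)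
    rw [norm_mul]
    exact mul_le_mul_of_nonneg_right (bd k z j) (norm_nonneg _)
  have L3 := (tendsto_finsetSum Finset.univ (fun j _ => L2 j)).neg
  simp_rw [← key] at L3
  have := tendsto_nhds_unique L1 L3
  simpa using this

lemma kg_norm_sq {n : ℕ} (L : EuclideanSpace ℝ (Fin n) →L[ℝ] ℝ) :
    ‖L‖ ^ 2 = ∑ j, (L (EuclideanSpace.single j (1 : ℝ))) ^ 2 := by
  obtain ⟨y, rfl⟩ := (InnerProductSpace.toDual ℝ (EuclideanSpace ℝ (Fin n))).surjective L
  rw [LinearIsometryEquiv.norm_map, EuclideanSpace.norm_sq_eq]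
  refine Finset.sum_congr rfl fun j _ => ?_
  simp [InnerProductSpace.toDual_apply_apply, EuclideanSpace.inner_single_right]

lemma kg_weight_integrable (n : ℕ) :
    Integrable (fun z : EuclideanSpace ℝ (Fin n) => ((1 + ‖z‖) ^ (n + 1))⁻¹) := by
  have := integrable_one_add_norm (E := EuclideanSpace ℝ (Fin n)) (μ := volume)
    (r := ((n + 1 : ℕ) : ℝ)) (by simp)
  refine this.congr (ae_of_all _ fun z => ?_)
  simp only
  rw [Real.rpow_neg (by positivity), Real.rpow_natCast]

section
variable {n : ℕ} {u : ℝ × EuclideanSpace ℝ (Fin n) → ℝ}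

lemma kg_hasDerivAt {G : Type*} [NormedAddCommGroup G] [NormedSpace ℝ G]
    {f : ℝ × EuclideanSpace ℝ (Fin n) → G} (hf : Differentiable ℝ f)
    (t : ℝ) (z : EuclideanSpace ℝ (Fin n)) :
    HasDerivAt (fun s => f (s, z)) (fderiv ℝ f (t, z) (1, 0)) t := by
  have h := (hf (t, z)).hasFDerivAt
  exact h.comp_hasDerivAt t ((hasDerivAt_id t).prodMk (hasDerivAt_const t z))

lemma kg_hasFDerivAt {G : Type*} [NormedAddCommGroup G] [NormedSpace ℝ G]
    {f : ℝ × EuclideanSpace ℝ (Fin n) → G} (hf : Differentiable ℝ f)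
    (t : ℝ) (z : EuclideanSpace ℝ (Fin n)) :
    HasFDerivAt (fun y => f (t, y))
      ((fderiv ℝ f (t, z)).comp (ContinuousLinearMap.inr ℝ ℝ _)) z := by
  have h := (hf (t, z)).hasFDerivAt
  exact h.comp z (hasFDerivAt_prodMk_right t z)

lemma kg_pt (hu : ContDiff ℝ 2 u) (t z) : pt u t z = fderiv ℝ u (t, z) (1, 0) :=
  (kg_hasDerivAt (hu.differentiable (by simp)) t z).deriv

lemma kg_gradz (hu : ContDiff ℝ 2 u) (t z) :
    gradz u t z = (fderiv ℝ u (t, z)).comp (ContinuousLinearMap.inr ℝ ℝ _) :=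
  (kg_hasFDerivAt (hu.differentiable (by simp)) t z).fderiv

lemma kg_D (hu : ContDiff ℝ 2 u) : ContDiff ℝ 1 (fderiv ℝ u) :=
  hu.fderiv_right (by norm_num)

lemma kg_D_apply (hu : ContDiff ℝ 2 u) (w) : ContDiff ℝ 1 (fun p => fderiv ℝ u p w) :=
  (kg_D hu).clm_apply contDiff_const

lemma kg_D_apply_fderiv (hu : ContDiff ℝ 2 u) (w p v) :
    fderiv ℝ (fun p => fderiv ℝ u p w) p v = fderiv ℝ (fderiv ℝ u) p v w := by
  have h := ((kg_D hu).differentiable (by simp) p).hasFDerivAt.clm_apply (hasFDerivAt_const w p)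
  rw [h.fderiv]; simp

lemma kg_symm (hu : ContDiff ℝ 2 u) (p v w) :
    fderiv ℝ (fderiv ℝ u) p v w = fderiv ℝ (fderiv ℝ u) p w v :=
  (hu.contDiffAt.isSymmSndFDerivAt (by simp)).eq v w

lemma kg_ptt (hu : ContDiff ℝ 2 u) (t z) :
    HasDerivAt (fun s => pt u s z) (ptt u t z) t := by
  have h := kg_hasDerivAt ((kg_D_apply hu (1, 0)).differentiable (by simp)) t z
  simp_rw [← kg_pt hu] at h
  have e : ptt u t z = _ := h.deriv
  rwa [e]

lemma kg_ptgradz (hu : ContDiff ℝ 2 u) (t z v) :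
    HasDerivAt (fun s => gradz u s z v) (ptgradz u t z v) t := by
  have h := kg_hasDerivAt ((kg_D hu).differentiable (by simp)) t z
  have h2 := h.clm_comp (hasDerivAt_const t (ContinuousLinearMap.inr ℝ ℝ (EuclideanSpace ℝ (Fin n))))
  simp_rw [← kg_gradz hu] at h2
  have e : ptgradz u t z = _ := h2.deriv
  rw [← e] at h2
  simpa using h2.clm_apply (hasDerivAt_const t v)

lemma kg_pt_fderiv (hu : ContDiff ℝ 2 u) (t z v) :
    fderiv ℝ (fun y => pt u t y) z v = ptgradz u t z v := by
  have h := kg_hasFDerivAt ((kg_D_apply hu (1, 0)).differentiable (by simp)) t z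
  have e0 : (fun y => pt u t y) = fun y => fderiv ℝ u (t, y) (1, 0) :=
    funext fun y => kg_pt hu t y
  rw [e0, h.fderiv]
  have h2 := kg_hasDerivAt ((kg_D_apply hu (0, v)).differentiable (by simp)) t z
  have e : (fun s => fderiv ℝ u (s, z) (0, v)) = fun s => gradz u s z v := by
    funext s; rw [kg_gradz hu]; simp
  rw [e] at h2
  rw [(kg_ptgradz hu t z v).unique h2]
  simp only [ContinuousLinearMap.comp_apply, ContinuousLinearMap.inr_apply]
  rw [kg_D_apply_fderiv hu, kg_D_apply_fderiv hu, kg_symm hu]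

lemma kg_slice {f : ℝ × EuclideanSpace ℝ (Fin n) → ℝ} {k : WithTop ℕ∞} (hf : ContDiff ℝ k f) (t) :
    ContDiff ℝ k (fun y => f (t, y)) := hf.comp (contDiff_prodMk_right t)

lemma kg_pt_contDiff (hu : ContDiff ℝ 2 u) (t) : ContDiff ℝ 1 (fun y => pt u t y) := by
  simp_rw [kg_pt hu]; exact kg_slice (kg_D_apply hu _) t

lemma kg_gradz_contDiff (hu : ContDiff ℝ 2 u) (t v) : ContDiff ℝ 1 (fun y => gradz u t y v) := by
  simp_rw [kg_gradz hu]; exact kg_slice (kg_D_apply hu (0, v)) t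

lemma kg_lapz (t z) : lapz u t z =
    ∑ j, fderiv ℝ (fun y => gradz u t y (EuclideanSpace.single j (1 : ℝ))) z
      (EuclideanSpace.single j (1 : ℝ)) := rfl

lemma kg_ptgradz_cont (hu : ContDiff ℝ 2 u) (t v) : Continuous (fun y => ptgradz u t y v) := by
  simp_rw [← kg_pt_fderiv hu]
  exact ((kg_pt_contDiff hu t).continuous_fderiv (by simp)).clm_apply continuous_const

lemma kg_lapz_cont (hu : ContDiff ℝ 2 u) (t) : Continuous (fun y => lapz u t y) := by
  simp_rw [kg_lapz]
  exact continuous_finsetSum _ fun j _ =>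
    ((kg_gradz_contDiff hu t _).continuous_fderiv (by simp)).clm_apply continuous_const

end

lemma kg_bounds {n : ℕ} {u : ℝ × EuclideanSpace ℝ (Fin n) → ℝ}
    (hdecay : ∀ a b : ℝ, ∃ C : ℝ, ∀ t ∈ Set.Icc a b, ∀ z : EuclideanSpace ℝ (Fin n),
      (1 + ‖z‖) ^ (n + 1) *
        (|u (t, z)| + |pt u t z| + |ptt u t z| + ‖gradz u t z‖ +
          ‖ptgradz u t z‖ + |lapz u t z|) ≤ C) (a b : ℝ) :
    ∃ C : ℝ, ∀ t ∈ Set.Icc a b, ∀ z : EuclideanSpace ℝ (Fin n), ∃ q : ℝ, 0 ≤ q ∧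
      |u (t, z)| ≤ q ∧ |pt u t z| ≤ q ∧ ‖gradz u t z‖ ≤ q ∧ ‖ptgradz u t z‖ ≤ q ∧
      |lapz u t z| ≤ q ∧ q ^ 2 ≤ C * ((1 + ‖z‖) ^ (n + 1))⁻¹ := by
  obtain ⟨C, hC⟩ := hdecay a b
  refine ⟨C ^ 2, fun t ht z => ⟨|u (t, z)| + |pt u t z| + |ptt u t z| + ‖gradz u t z‖ +
    ‖ptgradz u t z‖ + |lapz u t z|, ?_, ?_, ?_, ?_, ?_, ?_, ?_⟩⟩
  · positivity
  all_goals
    have h1 := abs_nonneg (u (t, z))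
    have h2 := abs_nonneg (pt u t z)
    have h3 := abs_nonneg (ptt u t z)
    have h4 := norm_nonneg (gradz u t z)
    have h5 := norm_nonneg (ptgradz u t z)
    have h6 := abs_nonneg (lapz u t z)
  · linarith
  · linarith
  · linarith
  · linarith
  · linarith
  · have h := hC t ht z
    have hq : 0 ≤ |u (t, z)| + |pt u t z| + |ptt u t z| + ‖gradz u t z‖ + ‖ptgradz u t z‖ +
      |lapz u t z| := by positivity
    clear hC
    generalize |u (t, z)| + |pt u t z| + |ptt u t z| + ‖gradz u t z‖ + ‖ptgradz u t z‖ +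
      |lapz u t z| = q at *
    have hw : (1 : ℝ) ≤ (1 + ‖z‖) ^ (n + 1) := one_le_pow₀ (by linarith [norm_nonneg z])
    generalize (1 + ‖z‖) ^ (n + 1) = w at *
    rw [← div_eq_mul_inv, le_div_iff₀ (by linarith)]
    have h7 : (w * q) ^ 2 ≤ C ^ 2 := pow_le_pow_left₀ (by positivity) h 2
    have h8 : q ^ 2 * w * 1 ≤ q ^ 2 * w * w := mul_le_mul_of_nonneg_left hw (by positivity)
    linarith [mul_pow w q 2]

lemma kg_integrable {n : ℕ} {f : EuclideanSpace ℝ (Fin n) → ℝ} (hf : Continuous f) (C : ℝ)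
    (h : ∀ z, |f z| ≤ C * ((1 + ‖z‖) ^ (n + 1))⁻¹) : Integrable f :=
  ((kg_weight_integrable n).const_mul C).mono' hf.aestronglyMeasurable (ae_of_all _ h)

lemma kg_sum_bound {n : ℕ} (L M : EuclideanSpace ℝ (Fin n) →L[ℝ] ℝ) (q : ℝ) (hL : ‖L‖ ≤ q)
    (hM : ‖M‖ ≤ q) :
    |∑ j, L (EuclideanSpace.single j (1 : ℝ)) * M (EuclideanSpace.single j (1 : ℝ))|
      ≤ n * q ^ 2 := by
  have : ∀ j ∈ (Finset.univ : Finset (Fin n)), |L (EuclideanSpace.single j (1 : ℝ)) *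
      M (EuclideanSpace.single j (1 : ℝ))| ≤ q ^ 2 := by
    intro j _
    have h1 := L.le_opNorm (EuclideanSpace.single j (1 : ℝ))
    have h2 := M.le_opNorm (EuclideanSpace.single j (1 : ℝ))
    simp at h1 h2
    rw [abs_mul, sq]
    exact mul_le_mul (h1.trans hL) (h2.trans hM) (abs_nonneg _) ((norm_nonneg _).trans hL)
  refine (Finset.abs_sum_le_sum_abs _ _).trans ((Finset.sum_le_sum this).trans ?_)
  simp

lemma kg_mul_bound {a b q : ℝ} (ha : |a| ≤ q) (hb : |b| ≤ q) : |a * b| ≤ q ^ 2 := by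
  rw [abs_mul, sq]
  exact mul_le_mul ha hb (abs_nonneg _) ((abs_nonneg _).trans ha)

/-- the flux term integrates to zero. -/
lemma kg_flux {n : ℕ} {u : ℝ × EuclideanSpace ℝ (Fin n) → ℝ} (hu : ContDiff ℝ 2 u)
    (hdecay : ∀ a b : ℝ, ∃ C : ℝ, ∀ t ∈ Set.Icc a b, ∀ z : EuclideanSpace ℝ (Fin n),
      (1 + ‖z‖) ^ (n + 1) *
        (|u (t, z)| + |pt u t z| + |ptt u t z| + ‖gradz u t z‖ +
          ‖ptgradz u t z‖ + |lapz u t z|) ≤ C) (t : ℝ) :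
    Integrable (fun z => pt u t z * lapz u t z +
      ∑ j, gradz u t z (EuclideanSpace.single j (1 : ℝ)) *
        ptgradz u t z (EuclideanSpace.single j (1 : ℝ))) ∧
    ∫ z, (pt u t z * lapz u t z +
      ∑ j, gradz u t z (EuclideanSpace.single j (1 : ℝ)) *
        ptgradz u t z (EuclideanSpace.single j (1 : ℝ))) = 0 := by
  obtain ⟨C, hC⟩ := kg_bounds hdecay t t
  have hC := hC t (by simp)
  have hI : Integrable (fun z => pt u t z * lapz u t z +
      ∑ j, gradz u t z (EuclideanSpace.single j (1 : ℝ)) *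
        ptgradz u t z (EuclideanSpace.single j (1 : ℝ))) := by
    refine kg_integrable ?_ ((1 + n) * C) fun z => ?_
    · refine ((kg_pt_contDiff hu t).continuous.mul (kg_lapz_cont hu t)).add
        (continuous_finsetSum _ fun j _ => ?_)
      exact (kg_gradz_contDiff hu t _).continuous.mul (kg_ptgradz_cont hu t _)
    · obtain ⟨q, hq, h1, h2, h3, h4, h5, h6⟩ := hC z
      refine (abs_add_le _ _).trans ((add_le_add (kg_mul_bound h2 h5)
        (kg_sum_bound _ _ q h3 h4)).trans ?_)
      have : (1 + (n : ℝ)) * q ^ 2 ≤ (1 + n) * (C * ((1 + ‖z‖) ^ (n + 1))⁻¹) :=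
        mul_le_mul_of_nonneg_left h6 (by positivity)
      linarith
  have e : (fun z => pt u t z * lapz u t z +
      ∑ j, gradz u t z (EuclideanSpace.single j (1 : ℝ)) *
        ptgradz u t z (EuclideanSpace.single j (1 : ℝ))) = fun z => ∑ j : Fin n, fderiv ℝ
        (fun y => pt u t y * gradz u t y (EuclideanSpace.single j (1 : ℝ))) z
        (EuclideanSpace.single j (1 : ℝ)) := by
    funext z
    rw [kg_lapz, Finset.mul_sum, ← Finset.sum_add_distrib]
    refine Finset.sum_congr rfl fun j _ => ?_
    rw [fderiv_fun_mul ((kg_pt_contDiff hu t).differentiable (by simp) z)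
      ((kg_gradz_contDiff hu t _).differentiable (by simp) z)]
    simp [kg_pt_fderiv hu]
  refine ⟨hI, ?_⟩
  rw [e] at hI ⊢
  refine kg_div_zero _ (fun j => (kg_pt_contDiff hu t).mul (kg_gradz_contDiff hu t _))
    (fun j => ?_) hI
  refine kg_integrable ((kg_pt_contDiff hu t).mul (kg_gradz_contDiff hu t _)).continuous C
    fun z => ?_
  obtain ⟨q, hq, h1, h2, h3, h4, h5, h6⟩ := hC z
  refine (kg_mul_bound h2 ?_).trans h6
  have h1 := (gradz u t z).le_opNorm (EuclideanSpace.single j (1 : ℝ))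
  simp at h1
  exact h1.trans h3

lemma kg_sq_integrable {n : ℕ} {u : ℝ × EuclideanSpace ℝ (Fin n) → ℝ} (hu : ContDiff ℝ 2 u)
    (hdecay : ∀ a b : ℝ, ∃ C : ℝ, ∀ t ∈ Set.Icc a b, ∀ z : EuclideanSpace ℝ (Fin n),
      (1 + ‖z‖) ^ (n + 1) *
        (|u (t, z)| + |pt u t z| + |ptt u t z| + ‖gradz u t z‖ +
          ‖ptgradz u t z‖ + |lapz u t z|) ≤ C) (t : ℝ) :
    Integrable (fun z => u (t, z) ^ 2) := by
  obtain ⟨C, hC⟩ := kg_bounds hdecay t t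
  refine kg_integrable ((kg_slice hu t).continuous.pow 2) C fun z => ?_
  obtain ⟨q, hq, h1, h2, h3, h4, h5, h6⟩ := hC t (by simp) z
  rw [sq (u (t, z))]
  exact (kg_mul_bound h1 h1).trans h6

section
variable {n : ℕ} {m : ℝ} {V u : ℝ × EuclideanSpace ℝ (Fin n) → ℝ}

lemma kg_density_integrable (hV : ContDiff ℝ 1 V) (hu : ContDiff ℝ 2 u)
    (hVbd : ∀ a b : ℝ, ∃ C : ℝ, ∀ t ∈ Set.Icc a b, ∀ z : EuclideanSpace ℝ (Fin n),
      |V (t, z)| ≤ C ∧ |deriv (fun s : ℝ => V (s, z)) t| ≤ C)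
    (hdecay : ∀ a b : ℝ, ∃ C : ℝ, ∀ t ∈ Set.Icc a b, ∀ z : EuclideanSpace ℝ (Fin n),
      (1 + ‖z‖) ^ (n + 1) *
        (|u (t, z)| + |pt u t z| + |ptt u t z| + ‖gradz u t z‖ +
          ‖ptgradz u t z‖ + |lapz u t z|) ≤ C) (t : ℝ) :
    Continuous (fun z => pt u t z ^ 2 + ‖gradz u t z‖ ^ 2 + (m ^ 2 + V (t, z)) * u (t, z) ^ 2) ∧
    Integrable (fun z => pt u t z ^ 2 + ‖gradz u t z‖ ^ 2 +
      (m ^ 2 + V (t, z)) * u (t, z) ^ 2) := by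
  obtain ⟨C, hC⟩ := kg_bounds hdecay t t
  obtain ⟨B, hB⟩ := hVbd t t
  have hcont : Continuous (fun z => pt u t z ^ 2 + ‖gradz u t z‖ ^ 2 +
      (m ^ 2 + V (t, z)) * u (t, z) ^ 2) := by
    simp_rw [kg_norm_sq]
    refine (((kg_pt_contDiff hu t).continuous.pow 2).add (continuous_finsetSum _ fun j _ =>
      (kg_gradz_contDiff hu t _).continuous.pow 2)).add ?_
    exact (continuous_const.add (kg_slice hV t).continuous).mul ((kg_slice hu t).continuous.pow 2)
  refine ⟨hcont, kg_integrable hcont ((2 + m ^ 2 + B) * C) fun z => ?_⟩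
  obtain ⟨q, hq, h1, h2, h3, h4, h5, h6⟩ := hC t (by simp) z
  obtain ⟨hb, -⟩ := hB t (by simp) z
  have hB0 : 0 ≤ B := (abs_nonneg _).trans hb
  have a1 : pt u t z ^ 2 ≤ q ^ 2 := sq_le_sq' (abs_le.1 h2).1 (abs_le.1 h2).2
  have a2 : u (t, z) ^ 2 ≤ q ^ 2 := sq_le_sq' (abs_le.1 h1).1 (abs_le.1 h1).2
  have a3 : ‖gradz u t z‖ ^ 2 ≤ q ^ 2 := pow_le_pow_left₀ (norm_nonneg _) h3 2
  have a4 : |(m ^ 2 + V (t, z)) * u (t, z) ^ 2| ≤ (m ^ 2 + B) * q ^ 2 := by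
    rw [abs_mul, abs_of_nonneg (sq_nonneg (u (t, z)))]
    refine mul_le_mul ((abs_add_le _ _).trans ?_) a2 (sq_nonneg _) (by positivity)
    rw [abs_of_nonneg (sq_nonneg m)]; linarith
  have a5 : (2 + m ^ 2 + B) * q ^ 2 ≤ (2 + m ^ 2 + B) * (C * ((1 + ‖z‖) ^ (n + 1))⁻¹) :=
    mul_le_mul_of_nonneg_left h6 (by positivity)
  refine (abs_add_le _ _).trans ?_
  rw [abs_of_nonneg (by positivity : 0 ≤ pt u t z ^ 2 + ‖gradz u t z‖ ^ 2)]
  linarith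

lemma kg_energy_deriv (hV : ContDiff ℝ 1 V) (hu : ContDiff ℝ 2 u)
    (hPDE : ∀ (t : ℝ) (z : EuclideanSpace ℝ (Fin n)),
      ptt u t z = lapz u t z - (m ^ 2 + V (t, z)) * u (t, z))
    (hVbd : ∀ a b : ℝ, ∃ C : ℝ, ∀ t ∈ Set.Icc a b, ∀ z : EuclideanSpace ℝ (Fin n),
      |V (t, z)| ≤ C ∧ |deriv (fun s : ℝ => V (s, z)) t| ≤ C)
    (hdecay : ∀ a b : ℝ, ∃ C : ℝ, ∀ t ∈ Set.Icc a b, ∀ z : EuclideanSpace ℝ (Fin n),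
      (1 + ‖z‖) ^ (n + 1) *
        (|u (t, z)| + |pt u t z| + |ptt u t z| + ‖gradz u t z‖ +
          ‖ptgradz u t z‖ + |lapz u t z|) ≤ C) (t : ℝ) :
    Integrable (fun z => deriv (fun s : ℝ => V (s, z)) t * u (t, z) ^ 2) ∧
    HasDerivAt (KGenergy m V u)
      ((1 / 2) * ∫ z, deriv (fun s : ℝ => V (s, z)) t * u (t, z) ^ 2) t := by
  have hVd : ∀ t z, HasDerivAt (fun s => V (s, z)) (deriv (fun s : ℝ => V (s, z)) t) t :=
    fun t z => (kg_hasDerivAt (hV.differentiable (by simp)) t z).differentiableAt.hasDerivAt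
  have hud : ∀ t z, HasDerivAt (fun s => u (s, z)) (pt u t z) t :=
    fun t z => (kg_hasDerivAt (hu.differentiable (by simp)) t z).differentiableAt.hasDerivAt
  have hVc : Continuous fun z => deriv (fun s : ℝ => V (s, z)) t := by
    have : (fun z => deriv (fun s : ℝ => V (s, z)) t) = fun z => fderiv ℝ V (t, z) (1, 0) :=
      funext fun z => (kg_hasDerivAt (hV.differentiable (by simp)) t z).deriv
    rw [this]
    exact ((hV.continuous_fderiv (by simp)).comp (by fun_prop)).clm_apply continuous_const
  obtain ⟨C, hC⟩ := kg_bounds hdecay (t - 1) (t + 1)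
  obtain ⟨B, hB⟩ := hVbd (t - 1) (t + 1)
  have htm : t ∈ Set.Icc (t - 1) (t + 1) := ⟨by linarith, by linarith⟩
  have hB0 : 0 ≤ B := (abs_nonneg _).trans (hB t htm 0).1
  have bV : ∀ s ∈ Set.Icc (t - 1) (t + 1), ∀ z, ∀ q, |u (s, z)| ≤ q →
      |deriv (fun s : ℝ => V (s, z)) s * u (s, z) ^ 2| ≤ B * q ^ 2 := by
    intro s hs z q h1
    have a2 : u (s, z) ^ 2 ≤ q ^ 2 := sq_le_sq' (abs_le.1 h1).1 (abs_le.1 h1).2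
    rw [abs_mul, abs_of_nonneg (sq_nonneg (u (s, z)))]
    exact mul_le_mul (hB s hs z).2 a2 (sq_nonneg _) hB0
  have hVi : Integrable (fun z => deriv (fun s : ℝ => V (s, z)) t * u (t, z) ^ 2) := by
    refine kg_integrable (hVc.mul ((kg_slice hu t).continuous.pow 2)) (B * C) fun z => ?_
    obtain ⟨q, hq, h1, h2, h3, h4, h5, h6⟩ := hC t htm z
    have := mul_le_mul_of_nonneg_left h6 hB0
    linarith [bV t htm z q h1]
  obtain ⟨hfi, hf0⟩ := kg_flux hu hdecay t
  refine ⟨hVi, ?_⟩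
  have main := hasDerivAt_integral_of_dominated_loc_of_deriv_le (𝕜 := ℝ)
    (μ := (volume : Measure (EuclideanSpace ℝ (Fin n)))) (x₀ := t)
    (s := Set.Icc (t - 1) (t + 1))
    (F := fun s z => pt u s z ^ 2 + ‖gradz u s z‖ ^ 2 + (m ^ 2 + V (s, z)) * u (s, z) ^ 2)
    (F' := fun s z => deriv (fun s : ℝ => V (s, z)) s * u (s, z) ^ 2 +
      2 * (pt u s z * lapz u s z + ∑ j, gradz u s z (EuclideanSpace.single j (1 : ℝ)) *
        ptgradz u s z (EuclideanSpace.single j (1 : ℝ))))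
    (bound := fun z => (B + 2 * (1 + n)) * (C * ((1 + ‖z‖) ^ (n + 1))⁻¹))
    (Icc_mem_nhds (by linarith) (by linarith))
    (Eventually.of_forall fun s =>
      (kg_density_integrable hV hu hVbd hdecay s).1.aestronglyMeasurable)
    (kg_density_integrable hV hu hVbd hdecay t).2
    (hVi.add (hfi.const_mul 2)).aestronglyMeasurable
    (ae_of_all _ fun z s hs => by
      obtain ⟨q, hq, h1, h2, h3, h4, h5, h6⟩ := hC s hs z
      have b1 := bV s hs z q h1
      have b2 := kg_mul_bound h2 h5
      have b3 := kg_sum_bound _ _ q h3 h4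
      have := mul_le_mul_of_nonneg_left h6 (by positivity : 0 ≤ B + 2 * (1 + n))
      rw [Real.norm_eq_abs]
      refine (abs_add_le _ _).trans ?_
      rw [abs_mul 2, abs_two]
      have b4 := abs_add_le (pt u s z * lapz u s z)
        (∑ j, gradz u s z (EuclideanSpace.single j (1 : ℝ)) *
          ptgradz u s z (EuclideanSpace.single j (1 : ℝ)))
      linarith)
    (((kg_weight_integrable n).const_mul C).const_mul _)
    (ae_of_all _ fun z s hs => by
      simp_rw [kg_norm_sq]
      have d1 := (kg_ptt hu s z).pow 2
      have d2 := HasDerivAt.fun_sum (u := Finset.univ) fun j _ =>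
        (kg_ptgradz hu s z (EuclideanSpace.single j (1 : ℝ))).pow 2
      have d3 := ((hVd s z).const_add (m ^ 2)).mul ((hud s z).pow 2)
      refine ((d1.add d2).add d3).congr_deriv ?_
      rw [hPDE, mul_add, Finset.mul_sum]
      simp only [Nat.cast_ofNat, Nat.add_one_sub_one, pow_one, mul_assoc, Pi.pow_apply]
      ring)
  have h2 := main.2.const_mul (1 / 2 : ℝ)
  refine h2.congr_deriv ?_
  rw [integral_add hVi (hfi.const_mul 2), integral_const_mul, hf0]
  simp

end

/-- under the hypotheses of the energy identity, if in addition
`m² + V ≥ c > 0` and `|∂_t V| ≤ C₀(1+t²)⁻¹` for `t ≤ t₀`, and the energy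
`E_u(t)` tends to `0` as `t → −∞`, then `u` vanishes identically for `t ≤ t₀`
(backwards Grönwall / uniqueness). -/
theorem stmt16 (n : ℕ) (hn : 1 ≤ n) (m : ℝ)
    (V u : ℝ × EuclideanSpace ℝ (Fin n) → ℝ)
    (hV : ContDiff ℝ 1 V) (hu : ContDiff ℝ 2 u)
    (hPDE : ∀ (t : ℝ) (z : EuclideanSpace ℝ (Fin n)),
      ptt u t z = lapz u t z - (m ^ 2 + V (t, z)) * u (t, z))
    (hVbd : ∀ a b : ℝ, ∃ C : ℝ, ∀ t ∈ Set.Icc a b, ∀ z : EuclideanSpace ℝ (Fin n),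
      |V (t, z)| ≤ C ∧ |deriv (fun s : ℝ => V (s, z)) t| ≤ C)
    (hdecay : ∀ a b : ℝ, ∃ C : ℝ, ∀ t ∈ Set.Icc a b, ∀ z : EuclideanSpace ℝ (Fin n),
      (1 + ‖z‖) ^ (n + 1) *
        (|u (t, z)| + |pt u t z| + |ptt u t z| + ‖gradz u t z‖ +
          ‖ptgradz u t z‖ + |lapz u t z|) ≤ C)
    (t₀ c C₀ : ℝ) (hc : 0 < c) (hC₀ : 0 ≤ C₀)
    (hcoerc : ∀ t ≤ t₀, ∀ z : EuclideanSpace ℝ (Fin n), c ≤ m ^ 2 + V (t, z))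
    (hVt : ∀ t ≤ t₀, ∀ z : EuclideanSpace ℝ (Fin n),
      |deriv (fun s : ℝ => V (s, z)) t| ≤ C₀ * (1 + t ^ 2)⁻¹)
    (hE0 : Tendsto (KGenergy m V u) atBot (𝓝 0)) :
    ∀ t ≤ t₀, ∀ z : EuclideanSpace ℝ (Fin n), u (t, z) = 0 := by
  intro t ht z
  have hVd := kg_energy_deriv hV hu hPDE hVbd hdecay
  have hu2 := kg_sq_integrable hu hdecay
  have hlow : ∀ s ≤ t₀, c / 2 * ∫ z, u (s, z) ^ 2 ≤ KGenergy m V u s := by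
    intro s hs
    have : ∫ z, c * u (s, z) ^ 2 ≤ ∫ z, (pt u s z ^ 2 + ‖gradz u s z‖ ^ 2 +
        (m ^ 2 + V (s, z)) * u (s, z) ^ 2) := by
      refine integral_mono ((hu2 s).const_mul c)
        (kg_density_integrable hV hu hVbd hdecay s).2 fun z => ?_
      have := mul_le_mul_of_nonneg_right (hcoerc s hs z) (sq_nonneg (u (s, z)))
      simp only
      nlinarith [sq_nonneg (pt u s z), sq_nonneg ‖gradz u s z‖]
    rw [integral_const_mul] at this
    unfold KGenergy
    linarith
  have hd : ∀ s ≤ t₀, (1 / 2) * ∫ z, deriv (fun s : ℝ => V (s, z)) s * u (s, z) ^ 2 ≤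
      C₀ / c * (1 + s ^ 2)⁻¹ * KGenergy m V u s := by
    intro s hs
    have : ∫ z, deriv (fun s : ℝ => V (s, z)) s * u (s, z) ^ 2 ≤
        ∫ z, C₀ * (1 + s ^ 2)⁻¹ * u (s, z) ^ 2 := by
      refine integral_mono (hVd s).1 ((hu2 s).const_mul _) fun z => ?_
      exact mul_le_mul_of_nonneg_right ((le_abs_self _).trans (hVt s hs z)) (sq_nonneg _)
    rw [integral_const_mul] at this
    have h1 := mul_le_mul_of_nonneg_left (hlow s hs)
      (by positivity : 0 ≤ C₀ / c * (1 + s ^ 2)⁻¹)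
    have h2 : C₀ / c * (1 + s ^ 2)⁻¹ * (c / 2 * ∫ z, u (s, z) ^ 2) =
      1 / 2 * (C₀ * (1 + s ^ 2)⁻¹ * ∫ z, u (s, z) ^ 2) := by
      field_simp
    linarith
  let g : ℝ → ℝ := fun s => KGenergy m V u s * Real.exp (-(C₀ / c) * Real.arctan s)
  have hg : ∀ s, HasDerivAt g
      (((1 / 2) * ∫ z, deriv (fun s : ℝ => V (s, z)) s * u (s, z) ^ 2) *
        Real.exp (-(C₀ / c) * Real.arctan s) + KGenergy m V u s *
        (Real.exp (-(C₀ / c) * Real.arctan s) * (-(C₀ / c) * (1 / (1 + s ^ 2))))) s := fun s =>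
    (hVd s).2.mul (((Real.hasDerivAt_arctan s).const_mul _).exp)
  have hanti : AntitoneOn g (Set.Iic t₀) := by
    refine antitoneOn_of_deriv_nonpos (convex_Iic t₀)
      (fun s _ => (hg s).continuousAt.continuousWithinAt)
      (fun s _ => (hg s).differentiableAt.differentiableWithinAt) fun s hs => ?_
    rw [interior_Iic] at hs
    rw [(hg s).deriv]
    have h1 := mul_le_mul_of_nonneg_right (hd s (le_of_lt hs))
      (Real.exp_pos (-(C₀ / c) * Real.arctan s)).le
    rw [one_div (1 + s ^ 2)]
    linarith
  have hglim : Tendsto g atBot (𝓝 0) := by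
    refine squeeze_zero_norm' (a := fun s => |KGenergy m V u s| *
      Real.exp (C₀ / c * (Real.pi / 2))) (Eventually.of_forall fun s => ?_) ?_
    · simp only [g]
      rw [norm_mul, Real.norm_eq_abs, Real.norm_eq_abs, Real.abs_exp]
      refine mul_le_mul_of_nonneg_left (Real.exp_le_exp.2 ?_) (abs_nonneg _)
      have := mul_le_mul_of_nonneg_left (Real.neg_pi_div_two_lt_arctan s).le
        (by positivity : 0 ≤ C₀ / c)
      linarith
    · simpa using hE0.abs.mul_const (Real.exp (C₀ / c * (Real.pi / 2)))
  have hg0 : g t ≤ 0 := by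
    refine ge_of_tendsto hglim ?_
    filter_upwards [eventually_le_atBot t] with s hs
    exact hanti (Set.mem_Iic.2 (hs.trans ht)) (Set.mem_Iic.2 ht) hs
  have hE : KGenergy m V u t ≤ 0 := by
    by_contra! h
    exact absurd (mul_pos h (Real.exp_pos (-(C₀ / c) * Real.arctan t))) (not_lt.2 hg0)
  have hz : ∫ z, u (t, z) ^ 2 = 0 := by
    have h1 := hlow t ht
    have h2 : 0 ≤ ∫ z, u (t, z) ^ 2 := integral_nonneg fun z => sq_nonneg _
    by_contra h
    have : 0 < ∫ z, u (t, z) ^ 2 := lt_of_le_of_ne h2 (Ne.symm h)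
    have := mul_pos (half_pos hc) this
    linarith
  rw [integral_eq_zero_iff_of_nonneg (fun z => sq_nonneg _) (hu2 t)] at hz
  have hcu : Continuous fun z => u (t, z) ^ 2 := (kg_slice hu t).continuous.pow 2
  have := congrFun ((hcu.ae_eq_iff_eq volume continuous_const).1 hz) z
  exact pow_eq_zero_iff (two_ne_zero) |>.1 this
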